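/- For all integers n ≥ 1 and k ≥ 1, the number r(n,k) of Catalan words of length n having exactly k runs of ascents satisfies k · r(n,k) = C(n-1, k-1) · C(n, k-1), i.e. r(n,k) is the Narayana number (1/k)·C(n-1,k-1)·C(n,k-1). -/

import Mathlib

/-- The set of Catalan words of length `n`: words `w` over ℕ with `w 1 = 0` and
`w (i+1) ≤ w i + 1` for all `i`. -/
def CatalanWord (n : ℕ) : Set (List ℕ) :=
  {w | w.length = n ∧ w.getD 0 0 = 0 ∧
    ∀ i, i + 1 < n → w.getD (i + 1) 0 ≤ w.getD i 0 + 1}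

/-- Number of runs of ascents of `w`: `1 + #{i : w i ≥ w (i+1)}`. -/
def ascRuns (w : List ℕ) : ℕ :=
  1 + ((Finset.range (w.length - 1)).filter
    (fun i => w.getD (i + 1) 0 ≤ w.getD i 0)).card

/-- Continuations of length `m` from last letter `h` having `j` non-ascents. -/
def contW : ℕ → ℕ → ℕ → Finset (List ℕ)
  | 0, 0, _ => {[]}
  | 0, _ + 1, _ => ∅
  | m + 1, 0, h => (contW m 0 (h + 1)).image (List.cons (h + 1))
  | m + 1, j + 1, h => (contW m (j + 1) (h + 1)).image (List.cons (h + 1)) ∪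
      (Finset.range (h + 1)).biUnion (fun a => (contW m j a).image (List.cons a))

lemma contW_card_zero (m h : ℕ) : (contW m 0 h).card = 1 := by
  induction m generalizing h with
  | zero => simp [contW]
  | succ m ih =>
    rw [contW, Finset.card_image_of_injective _ (List.cons_injective), ih]

lemma contW_card_succ (m j h : ℕ) : (contW (m + 1) (j + 1) h).card =
    (contW m (j + 1) (h + 1)).card + ∑ a ∈ Finset.range (h + 1), (contW m j a).card := by
  rw [contW, Finset.card_union_of_disjoint, Finset.card_biUnion,
    Finset.card_image_of_injective _ (List.cons_injective)]
  · congr 1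
    exact Finset.sum_congr rfl fun a _ =>
      Finset.card_image_of_injective _ (List.cons_injective)
  · intro a _ b _ hab
    refine Finset.disjoint_left.2 ?_
    intro t ht ht'
    simp only [Finset.mem_image] at ht ht'
    obtain ⟨u, _, rfl⟩ := ht
    obtain ⟨v, _, hv⟩ := ht'
    simp at hv
    exact hab hv.1.symm
  · rw [Finset.disjoint_left]
    intro t ht ht'
    simp only [Finset.mem_image, Finset.mem_biUnion, Finset.mem_range] at ht ht'
    obtain ⟨u, _, rfl⟩ := ht
    obtain ⟨a, ha, v, _, hv⟩ := ht'
    simp at hv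
    omega

/-- The closed form, in the integers. -/
def closedF (m : ℕ) : ℕ → ℕ → ℤ
  | 0, _ => 1
  | j + 1, h => (m.choose (j + 1) : ℤ) * ((m + h + 1).choose (j + 1) : ℤ)
      - ((m + 1).choose (j + 2) : ℤ) * ((m + h).choose j : ℤ)

lemma closedF_sum (m j h : ℕ) : closedF (m + 1) (j + 1) h =
    closedF m (j + 1) (h + 1) + ∑ a ∈ Finset.range (h + 1), closedF m j a := by
  induction h with
  | zero =>
    cases j with
    | zero =>
      simp [closedF, Nat.choose_succ_succ']
      ring
    | succ j =>
      simp [closedF, Nat.choose_succ_succ']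
      ring
  | succ h ih =>
    rw [Finset.sum_range_succ, ← add_assoc]
    have e : closedF (m + 1) (j + 1) (h + 1) - closedF (m + 1) (j + 1) h =
        closedF m (j + 1) (h + 2) - closedF m (j + 1) (h + 1) + closedF m j (h + 1) := by
      have e1 : m + 1 + (h + 1) = m + h + 1 + 1 := by ring
      have e2 : m + 1 + h = m + h + 1 := by ring
      have e3 : m + (h + 2) = m + h + 1 + 1 := by ring
      have e4 : m + (h + 1) = m + h + 1 := by ring
      cases j with
      | zero =>
        simp only [closedF, e1, e2, e3, e4]
        simp [Nat.choose_succ_succ']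
        try ring
      | succ j =>
        simp only [closedF, e1, e2, e3, e4]
        simp [Nat.choose_succ_succ']
        ring
    linarith

lemma contW_card (m j h : ℕ) : ((contW m j h).card : ℤ) = closedF m j h := by
  induction m generalizing j h with
  | zero =>
    cases j with
    | zero => simp [contW, closedF]
    | succ j => simp [contW, closedF, Nat.choose_succ_succ']
  | succ m ih =>
    cases j with
    | zero => simp [contW_card_zero, closedF]
    | succ j =>
      rw [contW_card_succ, closedF_sum]
      push_cast
      simp [ih]

lemma closedF_narayana (m j : ℕ) :
    ((j : ℤ) + 1) * closedF m j 0 = (m.choose j : ℤ) * ((m + 1).choose j : ℤ) := by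
  cases j with
  | zero => simp [closedF]
  | succ j =>
    have h1 : ((m : ℤ) + 1) * m.choose (j + 1) = (m + 1).choose (j + 2) * ((j : ℤ) + 2) := by
      have := Nat.add_one_mul_choose_eq m (j + 1)
      zify at this
      rw [this]; ring
    have h2 : ((m : ℤ) + 1) * m.choose j = (m + 1).choose (j + 1) * ((j : ℤ) + 1) := by
      have := Nat.add_one_mul_choose_eq m j
      zify at this
      rw [this]
    simp only [closedF, add_zero]
    push_cast
    linear_combination ((m.choose j : ℤ)) * h1 - (m.choose (j + 1) : ℤ) * h2

lemma mem_contW (m j h : ℕ) (t : List ℕ) : t ∈ contW m j h ↔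
    t.length = m ∧ (∀ i < m, (h :: t).getD (i + 1) 0 ≤ (h :: t).getD i 0 + 1) ∧
    ((Finset.range m).filter
      (fun i => (h :: t).getD (i + 1) 0 ≤ (h :: t).getD i 0)).card = j := by
  induction m generalizing j h t with
  | zero =>
    cases j with
    | zero => simp [contW]
    | succ j => simp [contW]
  | succ m ih =>
    cases t with
    | nil => cases j <;> simp [contW]
    | cons a t =>
      rw [Nat.forall_lt_succ_left, Finset.card_filter, Finset.sum_range_succ',
        ← Finset.card_filter]
      simp only [List.getD_cons_succ, List.getD_cons_zero, List.length_cons, Nat.add_right_cancel_iff, zero_add]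
      have key := fun j' => ih j' a t
      simp only [List.getD_cons_succ] at key
      cases j with
      | zero =>
        simp only [contW, Finset.mem_image, List.cons.injEq]
        constructor
        · rintro ⟨u, hu, rfl, rfl⟩
          obtain ⟨k1, k2, k3⟩ := (key 0).1 hu
          refine ⟨k1, ⟨le_refl _, k2⟩, ?_⟩
          rw [k3]; simp
        · rintro ⟨k1, ⟨k0, k2⟩, k3⟩
          split_ifs at k3 with hc
          obtain rfl : a = h + 1 := by omega
          exact ⟨t, (key 0).2 ⟨k1, k2, k3⟩, rfl, rfl⟩
      | succ j =>
        simp only [contW, Finset.mem_union, Finset.mem_biUnion, Finset.mem_range,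
          Finset.mem_image, List.cons.injEq]
        constructor
        · rintro (⟨u, hu, rfl, rfl⟩ | ⟨b, hb, u, hu, rfl, rfl⟩)
          · obtain ⟨k1, k2, k3⟩ := (key (j + 1)).1 hu
            refine ⟨k1, ⟨le_refl _, k2⟩, ?_⟩
            rw [k3]; simp
          · obtain ⟨k1, k2, k3⟩ := (key j).1 hu
            refine ⟨k1, ⟨by omega, k2⟩, ?_⟩
            rw [k3, if_pos (by omega)]
        · rintro ⟨k1, ⟨k0, k2⟩, k3⟩
          split_ifs at k3 with hc
          · exact Or.inr ⟨a, by omega, t, (key j).2 ⟨k1, k2, by omega⟩, rfl, rfl⟩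
          · obtain rfl : a = h + 1 := by omega
            exact Or.inl ⟨t, (key (j + 1)).2 ⟨k1, k2, k3⟩, rfl, rfl⟩

/-- The number of Catalan words of length `n` with exactly `k` runs of ascents is the
Narayana number `(1/k) C(n-1,k-1) C(n,k-1)`. -/
theorem ascRuns_count_narayana (n k : ℕ) (hn : 1 ≤ n) (hk : 1 ≤ k) :
    k * Nat.card {w : List ℕ | w ∈ CatalanWord n ∧ ascRuns w = k} =
      Nat.choose (n - 1) (k - 1) * Nat.choose n (k - 1) := by
  obtain ⟨m, rfl⟩ : ∃ m, n = m + 1 := ⟨n - 1, by omega⟩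
  obtain ⟨j, rfl⟩ : ∃ j, k = j + 1 := ⟨k - 1, by omega⟩
  have hset : {w : List ℕ | w ∈ CatalanWord (m + 1) ∧ ascRuns w = j + 1} =
      (((contW m j 0).image (List.cons 0) : Finset (List ℕ)) : Set (List ℕ)) := by
    ext w
    rw [Finset.mem_coe, Finset.mem_image]
    simp only [Set.mem_setOf_eq, CatalanWord, ascRuns]
    constructor
    · rintro ⟨⟨h1, h2, h3⟩, h4⟩
      cases w with
      | nil => simp at h1
      | cons a t =>
        obtain rfl : a = 0 := by simpa using h2
        refine ⟨t, (mem_contW m j 0 t).2 ⟨by simpa using h1, fun i hi => h3 i (by omega), ?_⟩, rfl⟩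
        rw [h1] at h4
        simp only [Nat.add_sub_cancel] at h4
        omega
    · rintro ⟨t, ht, rfl⟩
      obtain ⟨k1, k2, k3⟩ := (mem_contW m j 0 t).1 ht
      refine ⟨⟨by simp [k1], by simp, fun i hi => k2 i (by omega)⟩, ?_⟩
      simp only [List.length_cons, k1, Nat.add_sub_cancel]
      omega
  rw [hset, Nat.card_coe_set_eq, Set.ncard_coe_finset,
    Finset.card_image_of_injective _ (List.cons_injective)]
  simp only [Nat.add_sub_cancel]
  zify
  rw [contW_card]
  exact closedF_narayana m j
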